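/- Let q ∈ ℂ be nonzero and not a root of unity, let A be a unital associative ℂ-algebra, and let a, b, c, d ∈ A satisfy the SL_q(2) relations. For a natural number n, define the matrix $F \in M_{n+1}(A)$ (rows and columns indexed by l, k ∈ {0,…,n}) by $F_{lk} = \binom{n}{l}_{q^2}(-q)^{l}\,a^{n-l}c^{l}\,b^{k}d^{n-k}$. Then F is idempotent: F·F = F in the matrix ring $M_{n+1}(A)$. (F is the projector matrix $f_{n}$ giving the right projective module structure of the quantum Hopf line bundle of winding number $n$.) -/

import Mathlib

/-- The `x`-binomial coefficient
`(x-1)(x²-1)⋯(xⁿ-1) / [(x-1)⋯(x^k-1) · (x-1)⋯(x^(n-k)-1)]`. -/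
noncomputable def qbin (x : ℂ) (n k : ℕ) : ℂ :=
  (∏ i ∈ Finset.range n, (x ^ (i + 1) - 1)) /
    ((∏ i ∈ Finset.range k, (x ^ (i + 1) - 1)) *
      (∏ i ∈ Finset.range (n - k), (x ^ (i + 1) - 1)))

open Finset Polynomial in
/-- A `q`-binomial identity in the form of a convolution of sequences. -/
theorem sum_antidiagonal_pow_mul_qPochhammer {K R : Type*} [Field K] [CommRing R] [Algebra K R]
    (x : K) (hx : ∀ k : ℕ, x ^ (k + 1) - 1 ≠ 0) (u : R) (n : ℕ) :
    ∑ p ∈ antidiagonal n,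
      ((∏ i ∈ range p.1, (x ^ (i + 1) - 1)) * ∏ i ∈ range p.2, (x ^ (i + 1) - 1))⁻¹ •
        (u ^ p.1 * ∏ i ∈ range p.2, (1 - x ^ i • u)) =
      (∏ i ∈ range n, (x ^ (i + 1) - 1))⁻¹ • (1 : R) := by
  induction n with
  | zero => simp
  | succ n ih =>
    set P : ℕ → K := fun k => ∏ i ∈ range k, (x ^ (i + 1) - 1) with hP
    set f : ℕ × ℕ → R := fun p =>
      (P p.1 * P p.2)⁻¹ • (u ^ p.1 * ∏ i ∈ range p.2, (1 - x ^ i • u)) with hf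
    have hPs (k : ℕ) : P (k + 1) = P k * (x ^ (k + 1) - 1) := prod_range_succ _ _
    have hleft (p : ℕ × ℕ) : (x ^ p.2 * (x ^ (p.1 + 1) - 1)) • f (p.1 + 1, p.2) =
        x ^ p.2 • (u * f p) := by
      simp only [hf, hPs, mul_smul_comm, smul_smul]
      congr 1
      · rw [mul_inv, mul_inv, mul_inv]
        field_simp [hx p.1]
      · ring
    have hright (p : ℕ × ℕ) : (x ^ (p.2 + 1) - 1) • f (p.1, p.2 + 1) =
        f p - x ^ p.2 • (u * f p) := by
      have h : (x ^ (p.2 + 1) - 1) * (P p.1 * (P p.2 * (x ^ (p.2 + 1) - 1)))⁻¹ =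
          (P p.1 * P p.2)⁻¹ := by
        rw [mul_inv, mul_inv, mul_inv]
        field_simp [hx p.2]
      simp only [hf, hPs, smul_smul, h, prod_range_succ]
      rw [mul_smul_comm, smul_comm (x ^ p.2), ← smul_sub]
      congr 1
      simp only [Algebra.smul_def]
      ring
    have key : (x ^ (n + 1) - 1) • ∑ p ∈ antidiagonal (n + 1), f p =
        ∑ p ∈ antidiagonal n, f p := by
      have hsplit : (x ^ (n + 1) - 1) • ∑ p ∈ antidiagonal (n + 1), f p =
          ∑ p ∈ antidiagonal (n + 1), (x ^ p.2 - 1) • f p +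
            ∑ p ∈ antidiagonal (n + 1), (x ^ p.2 * (x ^ p.1 - 1)) • f p := by
        rw [smul_sum, ← sum_add_distrib]
        refine sum_congr rfl fun p hp => ?_
        rw [← add_smul, ← mem_antidiagonal.mp hp]
        congr 1
        ring
      rw [hsplit, Nat.sum_antidiagonal_succ', Nat.sum_antidiagonal_succ]
      simp only [pow_zero, sub_self, mul_zero, zero_smul, zero_add, hleft, hright,
        ← sum_add_distrib, sub_add_cancel]
    have h := key.trans ih
    change ∑ p ∈ antidiagonal (n + 1), f p = (P (n + 1))⁻¹ • (1 : R)
    rw [hPs, mul_inv, mul_comm, mul_smul]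
    exact (eq_inv_smul_iff₀ (hx n)).mpr h

open Finset Polynomial in
/-- If `d * a = 1 + q • t` and `t` `q ^ 2`-commutes with `a`, then `d ^ k * a ^ k` is a
polynomial in `t`. -/
theorem pow_mul_pow_eq_aeval {K A : Type*} [Field K] [Ring A] [Algebra K A] (q : K) (a d t : A)
    (hda : d * a = 1 + q • t) (hta : t * a = q ^ 2 • (a * t)) (k : ℕ) :
    d ^ k * a ^ k = aeval t (∏ i ∈ range k, (1 - (q ^ 2) ^ i • ((-q) • X : K[X]))) := by
  have htp (k : ℕ) : t * a ^ k = (q ^ 2) ^ k • (a ^ k * t) := by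
    induction k with
    | zero => simp
    | succ k ih =>
      rw [pow_succ a, ← mul_assoc, ih, smul_mul_assoc, mul_assoc, hta, mul_smul_comm, smul_smul,
        ← pow_succ, mul_assoc]
  induction k with
  | zero => simp
  | succ k ih =>
    rw [prod_range_succ, map_mul, ← ih, pow_succ d, pow_succ' a, mul_assoc, ← mul_assoc d a, hda,
      add_mul, one_mul, smul_mul_assoc, htp, mul_add]
    simp only [neg_smul, smul_neg, sub_neg_eq_add, map_add, map_one, map_smul, aeval_X, mul_add,
      mul_one, mul_smul_comm, smul_smul, mul_assoc, mul_comm q]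

open Finset Polynomial in
/-- The `q`-binomial sum that makes the line bundle projector idempotent. -/
theorem sum_qbin_smul_eq_one {A : Type*} [Ring A] [Algebra ℂ A] (q : ℂ)
    (hx : ∀ k : ℕ, (q ^ 2) ^ (k + 1) - 1 ≠ 0) (a b c d : A) (hbc : Commute b c)
    (hda : d * a = 1 + q • (b * c)) (hta : b * c * a = q ^ 2 • (a * (b * c))) (n : ℕ) :
    ∑ m ∈ range (n + 1), (qbin (q ^ 2) n m * (-q) ^ m) •
      (b ^ m * d ^ (n - m) * (a ^ (n - m) * c ^ m)) = 1 := by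
  have hterm (i j : ℕ) : (-q) ^ i • (b ^ i * d ^ j * (a ^ j * c ^ i)) =
      aeval (b * c) (((-q) • X : ℂ[X]) ^ i *
        ∏ m ∈ range j, (1 - (q ^ 2) ^ m • ((-q) • X : ℂ[X]))) := by
    have hc : Commute c (b * c) := hbc.symm.mul_right (Commute.refl c)
    have hdc : Commute (c ^ i) (d ^ j * a ^ j) := by
      rw [pow_mul_pow_eq_aeval q a d (b * c) hda hta]
      exact (Algebra.commute_of_mem_adjoin_singleton_of_commute
        (aeval_mem_adjoin_singleton ℂ _) hc).pow_left i
    rw [map_mul, ← pow_mul_pow_eq_aeval q a d (b * c) hda hta, map_pow, map_smul, aeval_X,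
      _root_.smul_pow, smul_mul_assoc, hbc.mul_pow, mul_assoc (b ^ i) (c ^ i), hdc.eq]
    simp only [mul_assoc]
  have h := congrArg (fun p => (∏ i ∈ range n, ((q ^ 2) ^ (i + 1) - 1)) • aeval (b * c) p)
    (sum_antidiagonal_pow_mul_qPochhammer (q ^ 2) hx ((-q) • X : ℂ[X]) n)
  simp only [map_smul, map_one, map_sum, ← hterm] at h
  rw [smul_inv_smul₀ (prod_ne_zero_iff.mpr fun i _ => hx i),
    Nat.sum_antidiagonal_eq_sum_range_succ_mk, smul_sum] at h
  rw [← h]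
  refine sum_congr rfl fun m _ => ?_
  simp only [smul_smul, qbin, div_eq_mul_inv, mul_assoc]

theorem stmt15 (q : ℂ) (hq : q ≠ 0) (hroot : ∀ k : ℕ, 0 < k → q ^ k ≠ 1)
    (A : Type*) [Ring A] [Algebra ℂ A] (a b c d : A)
    (hab : a * b = q⁻¹ • (b * a)) (hac : a * c = q⁻¹ • (c * a))
    (hbd : b * d = q⁻¹ • (d * b)) (hbc : b * c = c * b)
    (hcd : c * d = q⁻¹ • (d * c))
    (hadda : a * d - d * a = (q⁻¹ - q) • (b * c))
    (had : a * d - q⁻¹ • (b * c) = 1) (hda : d * a - q • (b * c) = 1)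
    (n : ℕ) (F : Matrix (Fin (n + 1)) (Fin (n + 1)) A)
    (hF : ∀ l k : Fin (n + 1), F l k =
      (qbin (q ^ 2) n l * (-q) ^ (l : ℕ)) •
        (a ^ (n - (l : ℕ)) * c ^ (l : ℕ) * b ^ (k : ℕ) * d ^ (n - (k : ℕ)))) :
    F * F = F := by
  have hx (k : ℕ) : (q ^ 2) ^ (k + 1) - 1 ≠ 0 := by
    rw [← pow_mul, sub_ne_zero]
    exact hroot _ (by positivity)
  have hba : b * a = q • (a * b) := by rw [hab, smul_inv_smul₀ hq]
  have hca : c * a = q • (a * c) := by rw [hac, smul_inv_smul₀ hq]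
  have hta : b * c * a = q ^ 2 • (a * (b * c)) := by
    rw [mul_assoc, hca, mul_smul_comm, ← mul_assoc, hba, smul_mul_assoc, smul_smul, sq, mul_assoc]
  have hsum := sum_qbin_smul_eq_one q hx a b c d hbc (sub_eq_iff_eq_add.mp hda) hta n
  ext l k
  calc (F * F) l k
      = (qbin (q ^ 2) n l * (-q) ^ (l : ℕ)) • (a ^ (n - (l : ℕ)) * c ^ (l : ℕ) *
          (∑ m ∈ Finset.range (n + 1), (qbin (q ^ 2) n m * (-q) ^ m) •
            (b ^ m * d ^ (n - m) * (a ^ (n - m) * c ^ m))) *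
          (b ^ (k : ℕ) * d ^ (n - (k : ℕ)))) := by
        rw [Matrix.mul_apply, Finset.sum_range, Finset.mul_sum, Finset.sum_mul, Finset.smul_sum]
        refine Finset.sum_congr rfl fun m _ => ?_
        simp only [hF, mul_smul_comm, smul_mul_assoc, mul_assoc]
        rw [smul_comm]
    _ = F l k := by rw [hsum, hF, mul_one]; simp only [mul_assoc]
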